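/- For every even positive integer n with n ≠ 4, Player 2 has a winning strategy in the Build Up 1-2-3 game on n. -/

import Mathlib

/-- The Fibonacci numbers indexed so that `zfib 1 = 1`, `zfib 2 = 2`,
and `zfib (i+1) = zfib i + zfib (i-1)`. -/
def zfib (i : ℕ) : ℕ := Nat.fib (i + 1)

/-- A game state: a finitely supported function recording the height of each bin.
Bin indices start at `1`; index `0` is unused. -/
abbrev ZState := ℕ →₀ ℕ

/-- The legal moves of the reversed Zeckendorf game. -/
inductive ZMove : ZState → ZState → Prop
  | split (h : ZState) (i : ℕ) (hi : 2 ≤ i) (hpos : 0 < h (i + 1)) :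
      ZMove h (h - Finsupp.single (i + 1) 1 + Finsupp.single i 1 + Finsupp.single (i - 1) 1)
  | splitTwo (h : ZState) (hpos : 0 < h 2) :
      ZMove h (h - Finsupp.single 2 1 + Finsupp.single 1 2)
  | combine (h : ZState) (i : ℕ) (hi : 2 < i) (h1 : 0 < h (i + 1)) (h2 : 0 < h (i - 2)) :
      ZMove h (h - Finsupp.single (i + 1) 1 - Finsupp.single (i - 2) 1 + Finsupp.single i 2)
  | combineTwo (h : ZState) (h1 : 0 < h 3) (h2 : 0 < h 1) :
      ZMove h (h - Finsupp.single 3 1 - Finsupp.single 1 1 + Finsupp.single 2 2)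

/-- A position of the Build Up 1-2-3 game on `n`: the running total `s` of the
building phase together with the current game state (which during the building
phase records the counts of played 1s, 2s and 3s in bins 1, 2 and 3). -/
abbrev BUPos := ℕ × ZState

/-- The legal moves of the Build Up 1-2-3 game on `n`: while the running total is
below `n`, put down a `1`, `2` or `3` without exceeding `n`; once the total is
exactly `n`, make reversed Zeckendorf moves on the accumulated state. -/
inductive BUMove (n : ℕ) : BUPos → BUPos → Prop
  | build (s : ℕ) (h : ZState) (k : ℕ) (hk : k = 1 ∨ k = 2 ∨ k = 3) (hs : s + k ≤ n) :
      BUMove n (s, h) (s + k, h + Finsupp.single k 1)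
  | play (h h' : ZState) (hm : ZMove h h') : BUMove n (n, h) (n, h')

mutual
  /-- The position is a win for the player to move. -/
  inductive BUFirstWin (n : ℕ) : BUPos → Prop
    | intro (p q : BUPos) (m : BUMove n p q) (hl : BULoss n q) : BUFirstWin n p
  /-- The position is a loss for the player to move. -/
  inductive BULoss (n : ℕ) : BUPos → Prop
    | intro (p : BUPos) (hall : ∀ q, BUMove n p q → BUFirstWin n q) : BULoss n p
end

/-- With `r` still to be built and the parities of the three bins (true = odd), does the
player to move lose? -/
def lossB : ℕ → Bool → Bool → Bool → Bool
  | 0, a, b, c => !a && !b && !c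
  | 1, a, b, c => !(lossB 0 (!a) b c)
  | 2, a, b, c => !(lossB 1 (!a) b c) && !(lossB 0 a (!b) c)
  | r + 3, a, b, c => !(lossB (r + 2) (!a) b c) && !(lossB (r + 1) a (!b) c) &&
      !(lossB r a b (!c))

theorem lossB_even (m : ℕ) : m ≠ 2 → lossB (2 * m) false false false = true := by
  induction m using Nat.strong_induction_on with
  | _ m ih =>
    intro hm
    by_cases h : m < 6
    · interval_cases m <;> first | decide | omega
    · obtain ⟨k, rfl⟩ : ∃ k, m = k + 6 := ⟨m - 6, by omega⟩
      have h1 := ih (k + 5) (by omega) (by omega)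
      have h2 := ih (k + 4) (by omega) (by omega)
      have h3 := ih (k + 3) (by omega) (by omega)
      have e0 : 2 * (k + 6) = (2 * k + 9) + 3 := by ring
      have e1 : 2 * (k + 5) = 2 * k + 10 := by ring
      have e2 : 2 * (k + 4) = 2 * k + 8 := by ring
      have e3 : 2 * (k + 3) = 2 * k + 6 := by ring
      rw [e1] at h1
      rw [e2] at h2
      rw [e3] at h3
      rw [e0, lossB]
      have t1 : lossB (2 * k + 9 + 2) true false false = false := by
        rw [show 2 * k + 9 + 2 = (2 * k + 8) + 3 by ring, lossB]
        simp [h1]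
      have t2 : lossB (2 * k + 9 + 1) false true false = false := by
        rw [show 2 * k + 9 + 1 = (2 * k + 7) + 3 by ring, lossB]
        simp [h2]
      have t3 : lossB (2 * k + 9) false false true = false := by
        rw [show 2 * k + 9 = (2 * k + 6) + 3 by ring, lossB]
        simp [h3]
      simp [t1, t2, t3]

def od (x : ℕ) : Bool := x % 2 == 1

theorem od_succ (x : ℕ) : od (x + 1) = !(od x) := by
  unfold od
  rcases Nat.mod_two_eq_zero_or_one x with h | h <;> simp [Nat.add_mod, h]

def lb (r : ℕ) (h : ZState) : Bool := lossB r (od (h 1)) (od (h 2)) (od (h 3))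

def PosInv (n : ℕ) (p : BUPos) : Prop :=
  (∀ i, 4 ≤ i → p.2 i = 0) ∧ p.1 ≤ n ∧ p.2 1 + 2 * p.2 2 + 3 * p.2 3 = p.1

theorem lb_build1 (r : ℕ) (h : ZState) :
    lb r (h + Finsupp.single 1 1) = lossB r (!od (h 1)) (od (h 2)) (od (h 3)) := by
  simp [lb, od_succ]

theorem lb_build2 (r : ℕ) (h : ZState) :
    lb r (h + Finsupp.single 2 1) = lossB r (od (h 1)) (!od (h 2)) (od (h 3)) := by
  simp [lb, od_succ]

theorem lb_build3 (r : ℕ) (h : ZState) :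
    lb r (h + Finsupp.single 3 1) = lossB r (od (h 1)) (od (h 2)) (!od (h 3)) := by
  simp [lb, od_succ]

theorem lb_zero (h : ZState) :
    lb 0 h = true ↔ h 1 % 2 = 0 ∧ h 2 % 2 = 0 ∧ h 3 % 2 = 0 := by
  simp [lb, lossB, od, and_assoc]

/-- A reversed Zeckendorf move, on a state supported in bins 1, 2, 3. -/
theorem zmove_cases {h h' : ZState} (h4 : ∀ i, 4 ≤ i → h i = 0) (m : ZMove h h') :
    (∀ i, 4 ≤ i → h' i = 0) ∧
    ((h' 1 = h 1 + 1 ∧ h' 2 = h 2 + 1 ∧ h' 3 + 1 = h 3) ∨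
     (h' 1 = h 1 + 2 ∧ h' 2 + 1 = h 2 ∧ h' 3 = h 3) ∨
     (h' 1 + 1 = h 1 ∧ h' 2 = h 2 + 2 ∧ h' 3 + 1 = h 3)) := by
  cases m with
  | split i hi hpos =>
    have : i = 2 := by
      by_contra hne
      have := h4 (i + 1) (by omega)
      omega
    subst this
    refine ⟨fun j hj => ?_, Or.inl ?_⟩
    · have := h4 j hj
      simp [Finsupp.single_apply]
      omega
    · simp [Finsupp.single_apply] at *
      omega
  | splitTwo hpos =>
    refine ⟨fun j hj => ?_, Or.inr (Or.inl ?_)⟩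
    · have := h4 j hj
      simp [Finsupp.single_apply]
      omega
    · simp [Finsupp.single_apply] at *
      omega
  | combine i hi h1 h2 =>
    have := h4 (i + 1) (by omega)
    omega
  | combineTwo h1 h2 =>
    refine ⟨fun j hj => ?_, Or.inr (Or.inr ?_)⟩
    · have := h4 j hj
      simp [Finsupp.single_apply]
      omega
    · simp [Finsupp.single_apply] at *
      omega

theorem inv_move {n : ℕ} {p q : BUPos} (hp : PosInv n p) (m : BUMove n p q) : PosInv n q := by
  obtain ⟨h4, hs, hsum⟩ := hp
  cases m with
  | build s h k hk hs' =>
    refine ⟨fun j hj => ?_, hs', ?_⟩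
    · have := h4 j hj
      simp only at this
      rcases hk with rfl | rfl | rfl <;> simp [Finsupp.single_apply, this] <;> omega
    · simp only at hsum
      rcases hk with rfl | rfl | rfl <;> simp [Finsupp.single_apply] <;> omega
  | play h h' hm =>
    obtain ⟨a, b⟩ := zmove_cases (h := h) h4 hm
    refine ⟨a, hs, ?_⟩
    simp only at hsum ⊢
    omega

theorem loss_move {n : ℕ} (hn : Even n) {p q : BUPos} (hp : PosInv n p)
    (hl : lb (n - p.1) p.2 = true) (m : BUMove n p q) : lb (n - q.1) q.2 = false := by
  obtain ⟨h4, hs, hsum⟩ := hp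
  cases m with
  | build s h k hk hs' =>
    simp only at *
    obtain ⟨r, hr⟩ : ∃ r, n = s + r := ⟨n - s, by omega⟩
    subst hr
    have hkr : k ≤ r := by omega
    rw [Nat.add_sub_cancel_left] at hl
    rw [Nat.add_sub_add_left]
    rcases r with _ | _ | _ | r
    · omega
    all_goals
      rcases hk with rfl | rfl | rfl <;>
      first
      | omega
      | (simp only [lb_build1, lb_build2, lb_build3]
         simp [lb, lossB] at hl ⊢
         try grind)
  | play h h' hm =>
    obtain ⟨a, b⟩ := zmove_cases (h := h) h4 hm
    simp only [Nat.sub_self] at *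
    rw [lb_zero] at hl
    rw [← Bool.not_eq_true, lb_zero]
    omega

theorem win_move {n : ℕ} (hn : Even n) {p : BUPos} (hp : PosInv n p)
    (hl : lb (n - p.1) p.2 = false) : ∃ q, BUMove n p q ∧ lb (n - q.1) q.2 = true := by
  obtain ⟨s, h⟩ := p
  obtain ⟨h4, hs, hsum⟩ := hp
  simp only at *
  obtain ⟨r, hr⟩ : ∃ r, n = s + r := ⟨n - s, by omega⟩
  have key : ∀ k, (k = 1 ∨ k = 2 ∨ k = 3) → k ≤ r →
      lb (r - k) (h + Finsupp.single k 1) = true →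
      ∃ q, BUMove n (s, h) q ∧ lb (n - q.1) q.2 = true := by
    intro k hk hkr hlb
    refine ⟨_, BUMove.build s h k hk (by omega), ?_⟩
    rw [hr, Nat.add_sub_add_left]
    exact hlb
  rcases r with _ | _ | _ | r
  · obtain rfl : n = s := hr
    rw [Nat.sub_self, ← Bool.not_eq_true, lb_zero] at hl
    rw [Nat.even_iff] at hn
    have fin : ∀ h', ZMove h h' → (h' 1 % 2 = 0 ∧ h' 2 % 2 = 0 ∧ h' 3 % 2 = 0) →
        ∃ q, BUMove n (n, h) q ∧ lb (n - q.1) q.2 = true := by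
      intro h' hm h2
      refine ⟨_, BUMove.play h h' hm, ?_⟩
      simp only [Nat.sub_self]
      rwa [lb_zero]
    by_cases hb : h 2 % 2 = 1
    · by_cases ha : h 1 % 2 = 1
      · refine fin _ (ZMove.split h 2 le_rfl (by simp only [Nat.reduceAdd]; omega)) ?_
        simp [Finsupp.single_apply]
        omega
      · refine fin _ (ZMove.splitTwo h (by omega)) ?_
        simp [Finsupp.single_apply]
        omega
    · refine fin _ (ZMove.combineTwo h (by omega) (by omega)) ?_
      simp [Finsupp.single_apply]
      omega
  · have k1 := key 1 (by omega) (by omega)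
    rw [lb_build1] at k1
    apply k1
    rw [hr, Nat.add_sub_cancel_left] at hl
    simpa [lb, lossB] using hl
  · have k1 := key 1 (by omega) (by omega)
    have k2 := key 2 (by omega) (by omega)
    rw [lb_build1] at k1
    rw [lb_build2] at k2
    rw [hr, Nat.add_sub_cancel_left] at hl
    by_contra hc
    have c1 := mt k1 hc
    have c2 := mt k2 hc
    simp [lb, lossB] at hl c1 c2
    grind
  · have k1 := key 1 (by omega) (by omega)
    have k2 := key 2 (by omega) (by omega)
    have k3 := key 3 (by omega) (by omega)
    rw [lb_build1] at k1
    rw [lb_build2] at k2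
    rw [lb_build3] at k3
    rw [hr, Nat.add_sub_cancel_left] at hl
    by_contra hc
    have c1 := mt k1 hc
    have c2 := mt k2 hc
    have c3 := mt k3 hc
    rw [show r + 1 + 1 + 1 - 1 = r + 2 by omega, Bool.not_eq_true] at c1
    rw [show r + 1 + 1 + 1 - 2 = r + 1 by omega, Bool.not_eq_true] at c2
    rw [show r + 1 + 1 + 1 - 3 = r by omega, Bool.not_eq_true] at c3
    simp [lb, lossB, c1, c2, c3] at hl

theorem not_win {n : ℕ} (hn : Even n) {p : BUPos} (hw : BUFirstWin n p) :
    PosInv n p → lb (n - p.1) p.2 = true → False := by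
  refine BUFirstWin.rec
    (motive_1 := fun p _ => PosInv n p → lb (n - p.1) p.2 = true → False)
    (motive_2 := fun q _ => PosInv n q → lb (n - q.1) q.2 = false → False) ?_ ?_ hw
  · intro p q m _ ih hi hl
    exact ih (inv_move hi m) (loss_move hn hi hl m)
  · intro p _ ih hi hl
    obtain ⟨q, m, hq⟩ := win_move hn hi hl
    exact ih q m (inv_move hi m) hq

/-- For every even positive integer `n ≠ 4`, Player 2 has a winning strategy in the
Build Up 1-2-3 game on `n`: the starting position is not a win for Player 1. -/
theorem buildUpGame_even_ne_four_not_firstPlayerWin (n : ℕ) (hpos : 0 < n)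
    (hn : Even n) (hn4 : n ≠ 4) : ¬ BUFirstWin n (0, 0) := by
  intro hw
  refine not_win hn hw ⟨by simp, by simp, by simp⟩ ?_
  obtain ⟨m, rfl⟩ := hn
  have := lossB_even m (by omega)
  rw [two_mul] at this
  simpa [lb, od] using this
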